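/- arXiv:1409.7601 — 5 statements merged into one kernel-verified Lean document; each statement's English description precedes it below -/
import Mathlib

section
/- Let L be a non-degenerate lattice and let ι be an involutive isometry of L (an automorphism of L preserving the bilinear form with ι² = id). Then the quotient abelian group L/(L^ι + L_ι) is isomorphic to (ℤ/2ℤ)^n for some natural number n with n ≤ min(rank L^ι, rank L_ι). -/
/-- The invariant sublattice `L^ι = {x ∈ L | ι x = x}` of an isometry `ι`. -/
def invSub {L : Type*} [AddCommGroup L] [Module ℤ L] (ι : L ≃ₗ[ℤ] L) : Submodule ℤ L :=
  LinearMap.ker (ι.toLinearMap - LinearMap.id)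

/-- The coinvariant sublattice `L_ι = (L^ι)^⊥ = {x ∈ L | ⟨x,y⟩ = 0 for all y ∈ L^ι}`
(for a symmetric form this agrees with Mathlib's `orthogonal`). -/
def coinvSub {L : Type*} [AddCommGroup L] [Module ℤ L] (B : L →ₗ[ℤ] L →ₗ[ℤ] ℤ)
    (ι : L ≃ₗ[ℤ] L) : Submodule ℤ L :=
  LinearMap.BilinForm.orthogonal B (invSub ι)

theorem aux_quot {L M : Type*} [AddCommGroup L] [Module ℤ L] [AddCommGroup M]
    [Module.Free ℤ M] [Module.Finite ℤ M] (f : L →+ M) (S : Submodule ℤ L)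
    (h : ∀ x, x ∈ S ↔ ∃ m, f x = m + m) :
    ∃ n : ℕ, n ≤ Module.finrank ℤ M ∧ Nonempty ((L ⧸ S) ≃+ (Fin n → ZMod 2)) := by
  classical
  let b := Module.finBasis ℤ M
  let r := Module.finrank ℤ M
  let g : L →+ (Fin r → ZMod 2) :=
    { toFun := fun x i => ((b.repr (f x) i : ℤ) : ZMod 2)
      map_zero' := by ext i; simp
      map_add' := by intro x y; ext i; simp }
  have hg : ∀ x, g x = 0 ↔ x ∈ S := by
    intro x
    rw [h]
    constructor
    · intro hx
      have h1 : ∀ i, ∃ c : ℤ, b.repr (f x) i = c + c := by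
        intro i
        have := congrFun hx i
        have h2 : ((b.repr (f x) i : ℤ) : ZMod 2) = 0 := this
        rw [ZMod.intCast_zmod_eq_zero_iff_dvd] at h2
        obtain ⟨c, hc⟩ := h2
        exact ⟨c, by rw [hc]; push_cast; ring⟩
      choose c hc using h1
      refine ⟨b.equivFun.symm c, ?_⟩
      apply b.equivFun.injective
      rw [map_add, LinearEquiv.apply_symm_apply]
      ext i
      exact hc i
    · rintro ⟨m, hm⟩
      ext i
      change ((b.repr (f x) i : ℤ) : ZMod 2) = 0
      rw [hm]
      simp [CharTwo.add_self_eq_zero]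
  have hk : S.toAddSubgroup = g.ker := by
    ext x
    rw [AddMonoidHom.mem_ker, hg]; rfl
  let e1 : (L ⧸ S) ≃+ g.range :=
    (QuotientAddGroup.quotientAddEquivOfEq hk).trans (QuotientAddGroup.quotientKerEquivRange g)
  let W : Submodule (ZMod 2) (Fin r → ZMod 2) := AddSubgroup.toZModSubmodule 2 g.range
  let e2 : g.range ≃+ W := AddEquiv.refl _
  refine ⟨Module.finrank (ZMod 2) W, ?_, ⟨(e1.trans e2).trans
    (Module.finBasis (ZMod 2) W).equivFun.toAddEquiv⟩⟩
  have := Submodule.finrank_le W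
  simpa [r] using this

/-- Let `L` be a non-degenerate lattice (a finite-rank free `ℤ`-module with a symmetric
bilinear form inducing an injection `L → Hom(L,ℤ)`) and `ι` an involutive isometry of `L`.
Then `L/(L^ι + L_ι) ≅ (ℤ/2ℤ)ⁿ` for some `n ≤ min (rank L^ι) (rank L_ι)`. -/
theorem stmt_0 {L : Type*} [AddCommGroup L] [Module ℤ L]
    [Module.Free ℤ L] [Module.Finite ℤ L]
    (B : L →ₗ[ℤ] L →ₗ[ℤ] ℤ)
    (hsymm : ∀ x y, B x y = B y x)
    (hnd : ∀ x : L, (∀ y, B x y = 0) → x = 0)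
    (ι : L ≃ₗ[ℤ] L)
    (hisom : ∀ x y, B (ι x) (ι y) = B x y)
    (hinv : ∀ x, ι (ι x) = x) :
    ∃ n : ℕ,
      n ≤ min (Module.finrank ℤ (invSub ι)) (Module.finrank ℤ (coinvSub B ι)) ∧
      Nonempty ((L ⧸ (invSub ι ⊔ coinvSub B ι)) ≃+ (Fin n → ZMod 2)) := by
  have hinst : ‹Module ℤ L› = AddCommGroup.toIntModule L := Subsingleton.elim _ _
  subst hinst
  have hF : ∀ P : Submodule ℤ L, Module.Free ℤ P := fun P => by
    have h : @Module.Free ℤ P _ _ P.module := inferInstance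
    convert h
  have hFin : ∀ P : Submodule ℤ L, Module.Finite ℤ P := fun P => by
    have h : @Module.Finite ℤ P _ _ P.module := Module.IsNoetherian.finite ℤ P
    convert h
  have := hF (invSub ι)
  have := hF (coinvSub B ι)
  have := hFin (invSub ι)
  have := hFin (coinvSub B ι)
  have hI : ∀ x, x ∈ invSub ι ↔ ι x = x := by
    intro x; simp [invSub, sub_eq_zero]
  have hC : ∀ x, x ∈ coinvSub B ι ↔ ι x = -x := by
    intro x
    have h0 : x ∈ coinvSub B ι ↔ ∀ y ∈ invSub ι, B y x = 0 := Iff.rfl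
    rw [h0]
    constructor
    · intro h
      have : ι x + x = 0 := by
        apply hnd
        intro y
        have h1 := h (ι y + y) (by rw [hI, map_add, hinv, add_comm])
        have h2 := hisom y (ι x)
        rw [hinv] at h2
        rw [map_add, LinearMap.add_apply, h2] at h1
        rw [hsymm, map_add]; exact h1
      exact eq_neg_of_add_eq_zero_left this
    · intro h y hy
      have h1 := hisom y x
      rw [(hI y).1 hy, h, map_neg] at h1
      omega
  have hS : ∀ x, x ∈ invSub ι ⊔ coinvSub B ι ↔
      ∃ p q, ι p = p ∧ ι q = -q ∧ p + q = x := by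
    intro x
    rw [Submodule.mem_sup]
    constructor
    · rintro ⟨p, hp, q, hq, h⟩
      exact ⟨p, q, (hI p).1 hp, (hC q).1 hq, h⟩
    · rintro ⟨p, q, hp, hq, h⟩
      exact ⟨p, (hI p).2 hp, q, (hC q).2 hq, h⟩
  obtain ⟨n, hn, ⟨e⟩⟩ := aux_quot
    (AddMonoidHom.mk' (fun x => (⟨x + ι x, by rw [hI]; simp [hinv, add_comm]⟩ : invSub ι))
      (by intro x y; apply Subtype.ext; simp; abel)) (invSub ι ⊔ coinvSub B ι) (by
    intro x
    rw [hS]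
    constructor
    · rintro ⟨p, q, hp, hq, rfl⟩
      refine ⟨⟨p, (hI p).2 hp⟩, Subtype.ext ?_⟩
      simp [hp, hq]
      abel
    · rintro ⟨⟨p, hp⟩, h⟩
      have h' : x + ι x = p + p := congrArg Subtype.val h
      have hp' := (hI p).1 hp
      refine ⟨p, x - p, hp', ?_, by abel⟩
      rw [map_sub, hp', eq_sub_of_add_eq' h']; abel)
  obtain ⟨m, hm, ⟨e'⟩⟩ := aux_quot
    (AddMonoidHom.mk' (fun x => (⟨x - ι x, by rw [hC]; simp [hinv]⟩ : coinvSub B ι))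
      (by intro x y; apply Subtype.ext; simp; abel)) (invSub ι ⊔ coinvSub B ι) (by
    intro x
    rw [hS]
    constructor
    · rintro ⟨p, q, hp, hq, rfl⟩
      refine ⟨⟨q, (hC q).2 hq⟩, Subtype.ext ?_⟩
      simp [hp, hq]
    · rintro ⟨⟨q, hq⟩, h⟩
      have h' : x - ι x = q + q := congrArg Subtype.val h
      have hq' := (hC q).1 hq
      refine ⟨x - q, q, ?_, hq', by abel⟩
      have h2 : ι x = x - (q + q) := by rw [← h']; abel
      rw [map_sub, hq', h2]; abel)
  have hc := Nat.card_congr (e.symm.trans e').toEquiv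
  have hnm : n = m := by
    simpa using hc
  subst hnm
  exact ⟨n, le_min hn hm, ⟨e⟩⟩
end

section
/- Let L be a non-degenerate lattice and let ι be an involutive isometry of L. Then the assignment x ↦ x + ι(x) induces a well-defined injective group homomorphism from L/(L^ι + L_ι) to L^ι/2L^ι. -/
/-- The submodule `2M` of `M`, i.e. the range of multiplication by `2`. -/
def twoSub (M : Type*) [AddCommGroup M] [Module ℤ M] : Submodule ℤ M :=
  LinearMap.range ((2 : ℤ) • (LinearMap.id : M →ₗ[ℤ] M))

/-- Let `L` be a non-degenerate lattice and `ι` an involutive isometry of `L`.  Then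
`x ↦ x + ι x` induces a well-defined injective group homomorphism
`L/(L^ι + L_ι) → L^ι/2L^ι`. -/
theorem stmt_1 {L : Type*} [AddCommGroup L] [Module ℤ L]
    [Module.Free ℤ L] [Module.Finite ℤ L]
    (B : L →ₗ[ℤ] L →ₗ[ℤ] ℤ)
    (hsymm : ∀ x y, B x y = B y x)
    (hnd : ∀ x : L, (∀ y, B x y = 0) → x = 0)
    (ι : L ≃ₗ[ℤ] L)
    (hisom : ∀ x y, B (ι x) (ι y) = B x y)
    (hinv : ∀ x, ι (ι x) = x) :
    ∃ f : (L ⧸ (invSub ι ⊔ coinvSub B ι)) →+ (↥(invSub ι) ⧸ twoSub ↥(invSub ι)),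
      Function.Injective f ∧
      ∀ (x : L) (h : x + ι x ∈ invSub ι),
        f (Submodule.Quotient.mk x) =
          Submodule.Quotient.mk (⟨x + ι x, h⟩ : ↥(invSub ι)) := by
  have mem : ∀ y : L, y ∈ invSub ι ↔ ι y = y := by
    intro y
    simp [invSub, sub_eq_zero]
  have hc : ∀ x : L, x ∈ coinvSub B ι ↔ ∀ y ∈ invSub ι, B y x = 0 := by
    intro x
    exact LinearMap.BilinForm.mem_orthogonal_iff
  have hg : ∀ x : L, x + ι x ∈ invSub ι := by
    intro x
    rw [mem, map_add, hinv, add_comm]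
  let g0 : L →+ invSub ι :=
    ((LinearMap.id + ι.toLinearMap).codRestrict (invSub ι) hg).toAddMonoidHom
  let g : L →ₗ[ℤ] invSub ι :=
    { toFun := g0
      map_add' := g0.map_add
      map_smul' := fun n x => map_intCast_smul g0 ℤ ℤ n x }
  have gv : ∀ x, ((g x : invSub ι) : L) = x + ι x := fun x => rfl
  let F : L →ₗ[ℤ] (↥(invSub ι) ⧸ twoSub ↥(invSub ι)) := (twoSub ↥(invSub ι)).mkQ.comp g
  have hF : ∀ x, F x = 0 ↔ ∃ z : L, ι z = z ∧ z + z = x + ι x := by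
    intro x
    have h1 : F x = 0 ↔ g x ∈ twoSub ↥(invSub ι) := Submodule.Quotient.mk_eq_zero _
    rw [h1]
    constructor
    · rintro ⟨z, hz⟩
      refine ⟨z, (mem _).1 z.2, ?_⟩
      rw [← gv, ← hz]
      simp [two_smul]
    · rintro ⟨z, hz, h⟩
      refine ⟨⟨z, (mem _).2 hz⟩, ?_⟩
      apply Subtype.ext
      rw [gv, ← h]
      simp [two_smul]
  have hker : LinearMap.ker F = invSub ι ⊔ coinvSub B ι := by
    apply le_antisymm
    · intro x hx
      obtain ⟨z, hz, h⟩ := (hF x).1 hx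
      refine Submodule.mem_sup.2 ⟨z, (mem z).2 hz, x - z, ?_, by abel⟩
      rw [hc]
      intro y hy
      have hw : ι (x - z) = -(x - z) := by
        have h2 : ι x = z + z - x := by rw [h]; abel
        rw [map_sub, hz, h2]; abel
      have h3 := hisom y (x - z)
      rw [(mem y).1 hy, hw, map_neg] at h3
      omega
    · apply sup_le
      · intro x hx
        have hx' := (mem x).1 hx
        exact (hF x).2 ⟨x, hx', by rw [hx']⟩
      · intro x hx
        refine (hF x).2 ⟨0, map_zero _, ?_⟩
        rw [add_zero]
        symm
        apply hnd
        intro y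
        have h1 := (hc x).1 hx _ (hg y)
        have h2 := hisom x (ι y)
        rw [hinv] at h2
        rw [map_add, LinearMap.add_apply, h2, hsymm x y, hsymm x (ι y)]
        rwa [map_add, LinearMap.add_apply] at h1
  refine ⟨((invSub ι ⊔ coinvSub B ι).liftQ F hker.ge).toAddMonoidHom, ?_, ?_⟩
  · rw [injective_iff_map_eq_zero]
    intro q
    obtain ⟨x, rfl⟩ := Submodule.Quotient.mk_surjective _ q
    intro hx
    have hx' : F x = 0 := hx
    rw [Submodule.Quotient.mk_eq_zero, ← hker]
    exact hx'
  · intro x h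
    rfl
end

section
/- Let L be a non-degenerate even lattice and let M be a ℤ-submodule of L^∨ (inside L ⊗ ℚ) with L ⊆ M. Then M is an even overlattice of L — that is, the ℚ-bilinearly extended form takes integer values on M × M and ⟨x,x⟩ ∈ 2ℤ for all x ∈ M — if and only if the image of M in the discriminant group A(L) = L^∨/L is an isotropic subgroup. Moreover, the assignment M ↦ M/L is a one-to-one correspondence between the set of even overlattices of L and the set of isotropic subgroups of A(L). -/
/-- The dual lattice `L^∨ = {x ∈ L ⊗ ℚ | ⟨x,y⟩ ∈ ℤ for all y ∈ L}` of a lattice `L`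
inside the ambient rational vector space `V = L ⊗ ℚ`. -/
def dualLattice {V : Type*} [AddCommGroup V] [Module ℚ V]
    (Φ : V →ₗ[ℚ] V →ₗ[ℚ] ℚ) (L : Submodule ℤ V) : Submodule ℤ V where
  carrier := {x | ∀ y ∈ L, ∃ n : ℤ, Φ x y = (n : ℚ)}
  add_mem' := by
    intro a b ha hb y hy
    obtain ⟨n, hn⟩ := ha y hy
    obtain ⟨m, hm⟩ := hb y hy
    exact ⟨n + m, by rw [map_add, LinearMap.add_apply, hn, hm]; push_cast; ring⟩
  zero_mem' := by
    intro y hy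
    exact ⟨0, by simp⟩
  smul_mem' := by
    intro c x hx y hy
    obtain ⟨n, hn⟩ := hx y hy
    refine ⟨c * n, ?_⟩
    rw [← Int.cast_smul_eq_zsmul ℚ c x, map_smul, LinearMap.smul_apply, hn, smul_eq_mul]
    push_cast; ring

/-- Let `L` be a non-degenerate even lattice, realized as a full finitely generated
`ℤ`-submodule of a finite-dimensional rational vector space `V = L ⊗ ℚ` carrying a
symmetric non-degenerate bilinear form `Φ` which is integral and even on `L`.
For a `ℤ`-submodule `M` of `L^∨` with `L ⊆ M`:

* `M` is an even overlattice of `L` (the form is integer-valued on `M × M` and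
  `⟨x,x⟩ ∈ 2ℤ` for `x ∈ M`) if and only if the image `M/L` of `M` in the
  discriminant group `A(L) = L^∨/L` is an isotropic subgroup (the discriminant
  quadratic form `x ↦ ⟨x,x⟩ mod 2ℤ` vanishes on it);

* moreover `M ↦ M/L` is a one-to-one correspondence between the set of even
  overlattices of `L` and the set of isotropic subgroups of `A(L)`.

Here subgroups of `A(L) = L^∨/L` are represented as submodules of `V/L` contained in
the image of `L^∨`. -/
theorem stmt_3 {V : Type*} [AddCommGroup V] [Module ℚ V] [FiniteDimensional ℚ V]
    (Φ : V →ₗ[ℚ] V →ₗ[ℚ] ℚ)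
    (hsymm : ∀ x y, Φ x y = Φ y x)
    (hnd : ∀ x : V, (∀ y, Φ x y = 0) → x = 0)
    (L : Submodule ℤ V) (hfg : L.FG)
    (hspan : Submodule.span ℚ (L : Set V) = ⊤)
    (hint : ∀ x ∈ L, ∀ y ∈ L, ∃ n : ℤ, Φ x y = (n : ℚ))
    (heven : ∀ x ∈ L, ∃ n : ℤ, Φ x x = 2 * (n : ℚ)) :
    (∀ M : Submodule ℤ V, L ≤ M → M ≤ dualLattice Φ L →
      (((∀ x ∈ M, ∀ y ∈ M, ∃ n : ℤ, Φ x y = (n : ℚ)) ∧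
          (∀ x ∈ M, ∃ n : ℤ, Φ x x = 2 * (n : ℚ))) ↔
        (∀ x ∈ dualLattice Φ L, L.mkQ x ∈ M.map L.mkQ →
          ∃ n : ℤ, Φ x x = 2 * (n : ℚ)))) ∧
    Set.BijOn (fun M : Submodule ℤ V => M.map L.mkQ)
      {M : Submodule ℤ V | L ≤ M ∧
        (∀ x ∈ M, ∀ y ∈ M, ∃ n : ℤ, Φ x y = (n : ℚ)) ∧
        (∀ x ∈ M, ∃ n : ℤ, Φ x x = 2 * (n : ℚ))}
      {S : Submodule ℤ (V ⧸ L) | S ≤ (dualLattice Φ L).map L.mkQ ∧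
        ∀ x ∈ dualLattice Φ L, L.mkQ x ∈ S → ∃ n : ℤ, Φ x x = 2 * (n : ℚ)} := by
  have hmem : ∀ M : Submodule ℤ V, L ≤ M → ∀ x, L.mkQ x ∈ M.map L.mkQ ↔ x ∈ M := by
    intro M hM x
    rw [← Submodule.mem_comap, Submodule.comap_map_mkQ, sup_eq_right.mpr hM]
  have hLd : L ≤ dualLattice Φ L := fun x hx y hy => hint x hx y hy
  have hpol : ∀ M : Submodule ℤ V, (∀ x ∈ M, ∃ n : ℤ, Φ x x = 2 * (n : ℚ)) →
      ∀ x ∈ M, ∀ y ∈ M, ∃ n : ℤ, Φ x y = (n : ℚ) := by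
    intro M h x hx y hy
    obtain ⟨a, ha⟩ := h x hx
    obtain ⟨b, hb⟩ := h y hy
    obtain ⟨c, hc⟩ := h (x + y) (M.add_mem hx hy)
    refine ⟨c - a - b, ?_⟩
    simp only [map_add, LinearMap.add_apply] at hc
    have := hsymm x y
    push_cast
    linarith
  refine ⟨?_, ?_, ?_, ?_⟩
  · intro M hL hd
    constructor
    · rintro ⟨-, h⟩ x _ hx
      exact h x ((hmem M hL x).1 hx)
    · intro h
      have h2 : ∀ x ∈ M, ∃ n : ℤ, Φ x x = 2 * (n : ℚ) :=
        fun x hx => h x (hd hx) ((hmem M hL x).2 hx)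
      exact ⟨hpol M h2, h2⟩
  · rintro M ⟨hL, h1, h2⟩
    refine ⟨Submodule.map_mono fun x hx y hy => h1 x hx y (hL hy), ?_⟩
    intro x _ hx
    exact h2 x ((hmem M hL x).1 hx)
  · rintro M ⟨hL, -⟩ N ⟨hN, -⟩ h
    ext x
    rw [← hmem M hL, ← hmem N hN]
    exact Iff.of_eq (congrArg (fun S => L.mkQ x ∈ S) h)
  · rintro S ⟨hS, h⟩
    have h2 : ∀ x ∈ S.comap L.mkQ, ∃ n : ℤ, Φ x x = 2 * (n : ℚ) :=
      fun x hx => h x ((hmem _ hLd x).1 (hS hx)) hx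
    refine ⟨S.comap L.mkQ, ⟨Submodule.le_comap_mkQ L S, hpol _ h2, h2⟩, ?_⟩
    exact Submodule.map_comap_eq_of_surjective L.mkQ_surjective S
end

section
/- Let L be an even unimodular lattice and let M be a primitive non-degenerate sublattice of L with orthogonal complement M^⊥ (also non-degenerate). Then there is an isomorphism of abelian groups A(M) ≅ A(M^⊥) under which the discriminant quadratic form q(M) corresponds to −q(M^⊥), i.e. a group isomorphism f : A(M) → A(M^⊥) with q(M^⊥)(f(x)) = −q(M)(x) in ℚ/2ℤ for all x ∈ A(M). -/
/-- The set of vectors pairing integrally with a lattice `M`: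
`{x ∈ V | ⟨x,y⟩ ∈ ℤ for all y ∈ M}`. -/
def integralPairing {V : Type*} [AddCommGroup V] [Module ℚ V]
    (Φ : V →ₗ[ℚ] V →ₗ[ℚ] ℚ) (M : Submodule ℤ V) : Submodule ℤ V where
  carrier := {x | ∀ y ∈ M, ∃ n : ℤ, Φ x y = (n : ℚ)}
  add_mem' := by
    intro a b ha hb y hy
    obtain ⟨n, hn⟩ := ha y hy
    obtain ⟨m, hm⟩ := hb y hy
    exact ⟨n + m, by rw [map_add, LinearMap.add_apply, hn, hm]; push_cast; ring⟩
  zero_mem' := by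
    intro y hy
    exact ⟨0, by simp⟩
  smul_mem' := by
    intro c x hx y hy
    obtain ⟨n, hn⟩ := hx y hy
    refine ⟨c * n, ?_⟩
    rw [← Int.cast_smul_eq_zsmul ℚ c x, map_smul, LinearMap.smul_apply, hn, smul_eq_mul]
    push_cast; ring

/-- The dual lattice `M^∨ = {x ∈ M ⊗ ℚ | ⟨x,y⟩ ∈ ℤ for all y ∈ M}` of a (not
necessarily full) sublattice `M` of the ambient space `V`; here `M ⊗ ℚ` is realized
as the `ℚ`-span of `M` in `V`. -/
def dualLatticeIn {V : Type*} [AddCommGroup V] [Module ℚ V]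
    (Φ : V →ₗ[ℚ] V →ₗ[ℚ] ℚ) (M : Submodule ℤ V) : Submodule ℤ V :=
  (Submodule.span ℚ (M : Set V)).restrictScalars ℤ ⊓ integralPairing Φ M

/-- The discriminant group `A(M) = M^∨/M` of a lattice `M`. -/
abbrev discGroup {V : Type*} [AddCommGroup V] [Module ℚ V]
    (Φ : V →ₗ[ℚ] V →ₗ[ℚ] ℚ) (M : Submodule ℤ V) : Type _ :=
  ↥(dualLatticeIn Φ M) ⧸ Submodule.comap (dualLatticeIn Φ M).subtype M

/-- The orthogonal complement `M^⊥ = {x ∈ L | ⟨x,y⟩ = 0 for all y ∈ M}` of `M` in `L`. -/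
def perpIn {V : Type*} [AddCommGroup V] [Module ℚ V]
    (Φ : V →ₗ[ℚ] V →ₗ[ℚ] ℚ) (L M : Submodule ℤ V) : Submodule ℤ V where
  carrier := {x | x ∈ L ∧ ∀ y ∈ M, Φ x y = 0}
  add_mem' := by
    rintro a b ⟨haL, ha⟩ ⟨hbL, hb⟩
    exact ⟨L.add_mem haL hbL, fun y hy => by
      rw [map_add, LinearMap.add_apply, ha y hy, hb y hy, add_zero]⟩
  zero_mem' := ⟨L.zero_mem, fun y hy => by simp⟩
  smul_mem' := by
    rintro c x ⟨hxL, hx⟩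
    refine ⟨L.smul_mem c hxL, fun y hy => ?_⟩
    rw [← Int.cast_smul_eq_zsmul ℚ c x, map_smul, LinearMap.smul_apply, hx y hy, smul_zero]

lemma aux_clear {V : Type*} [AddCommGroup V] [Module ℚ V] (S : Submodule ℤ V) (z : V)
    (hz : z ∈ Submodule.span ℚ (S : Set V)) : ∃ n : ℤ, n ≠ 0 ∧ n • z ∈ S := by
  induction hz using Submodule.span_induction with
  | mem x hx => exact ⟨1, one_ne_zero, by simpa using hx⟩
  | zero => exact ⟨1, one_ne_zero, by simp⟩
  | add x y _ _ hx hy =>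
    obtain ⟨n, hn, hx⟩ := hx
    obtain ⟨m, hm, hy⟩ := hy
    refine ⟨n * m, mul_ne_zero hn hm, ?_⟩
    rw [smul_add]
    refine S.add_mem ?_ ?_
    · rw [mul_comm, mul_smul]; exact S.smul_mem _ hx
    · rw [mul_smul]; exact S.smul_mem _ hy
  | smul a x _ hx =>
    obtain ⟨n, hn, hx⟩ := hx
    refine ⟨n * a.den, mul_ne_zero hn (by exact_mod_cast a.den_nz), ?_⟩
    have : (n * (a.den : ℤ)) • a • x = a.num • n • x := by
      rw [← Int.cast_smul_eq_zsmul ℚ, ← Int.cast_smul_eq_zsmul ℚ a.num,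
        ← Int.cast_smul_eq_zsmul ℚ n, smul_smul, smul_smul]
      congr 1
      push_cast
      rw [mul_assoc, Rat.den_mul_eq_num, mul_comm]
    rw [this]
    exact S.smul_mem _ hx

lemma aux_zsmul_eq_zero {V : Type*} [AddCommGroup V] [Module ℚ V] (n : ℤ) (hn : n ≠ 0) (z : V)
    (h : n • z = 0) : z = 0 := by
  rw [← Int.cast_smul_eq_zsmul ℚ] at h
  exact (smul_eq_zero.1 h).resolve_left (by exact_mod_cast hn)

lemma aux_map_zsmul {V : Type*} [AddCommGroup V] [Module ℚ V]
    (Φ : V →ₗ[ℚ] V →ₗ[ℚ] ℚ) (n : ℤ) (x y : V) : Φ (n • x) y = n * Φ x y := by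
  rw [← Int.cast_smul_eq_zsmul ℚ, map_smul, LinearMap.smul_apply, smul_eq_mul]

lemma aux_orth {V : Type*} [AddCommGroup V] [Module ℚ V]
    (Φ : V →ₗ[ℚ] V →ₗ[ℚ] ℚ) (S : Set V) (x : V) (h : ∀ y ∈ S, Φ x y = 0) :
    ∀ y ∈ Submodule.span ℚ S, Φ x y = 0 := by
  intro y hy
  have : Submodule.span ℚ S ≤ LinearMap.ker (Φ x) := Submodule.span_le.2 h
  exact this hy

lemma aux_nd {V : Type*} [AddCommGroup V] [Module ℚ V]
    (Φ : V →ₗ[ℚ] V →ₗ[ℚ] ℚ) (S : Submodule ℤ V)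
    (hSnd : ∀ x ∈ S, (∀ y ∈ S, Φ x y = 0) → x = 0)
    (z : V) (hz : z ∈ Submodule.span ℚ (S : Set V)) (h : ∀ y ∈ S, Φ z y = 0) : z = 0 := by
  obtain ⟨n, hn, hnz⟩ := aux_clear S z hz
  refine aux_zsmul_eq_zero n hn z (hSnd _ hnz fun y hy => ?_)
  rw [aux_map_zsmul, h y hy, mul_zero]

lemma aux_extend {V : Type*} [AddCommGroup V] [Module ℚ V]
    (L : Submodule ℤ V) (hfg : L.FG)
    (hspan : Submodule.span ℚ (L : Set V) = ⊤) (r : L →ₗ[ℤ] ℚ) :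
    ∃ R : V →ₗ[ℚ] ℚ, ∀ l : L, R l = r l := by
  haveI : Module.Finite ℤ L := Module.Finite.iff_fg.2 hfg
  haveI : Module.IsTorsionFree ℤ V := Module.IsTorsionFree.trans ℚ
  haveI : Module.Free ℤ L := inferInstance
  let b := Module.Free.chooseBasis ℤ L
  have hli : LinearIndependent ℤ (fun i => (b i : V)) :=
    b.linearIndependent.map' L.subtype (by simp)
  have hliQ : LinearIndependent ℚ (fun i => (b i : V)) :=
    (LinearIndependent.iff_fractionRing ℤ ℚ).1 hli
  have hsp : ⊤ ≤ Submodule.span ℚ (Set.range (fun i => (b i : V))) := by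
    rw [← hspan, Submodule.span_le]
    intro x hx
    have := b.sum_repr ⟨x, hx⟩
    have h2 := congrArg (L.subtype) this
    rw [map_sum] at h2
    simp only [map_smul, Submodule.subtype_apply] at h2
    rw [← h2]
    refine Submodule.sum_mem _ fun i _ => ?_
    rw [← Int.cast_smul_eq_zsmul ℚ]
    exact Submodule.smul_mem _ _ (Submodule.subset_span ⟨i, rfl⟩)
  let B := Module.Basis.mk hliQ hsp
  refine ⟨B.constr ℚ (fun i => r (b i)), fun l => ?_⟩
  have : ((B.constr ℚ (fun i => r (b i))).restrictScalars ℤ).comp L.subtype = r := by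
    refine b.ext fun i => ?_
    have h1 : (b i : V) = B i := by simp [B]
    simp only [LinearMap.comp_apply, LinearMap.restrictScalars_apply, Submodule.subtype_apply]
    rw [h1, Module.Basis.constr_basis]
  exact LinearMap.congr_fun this l

lemma aux_lift {V : Type*} [AddCommGroup V] [Module ℚ V] [FiniteDimensional ℚ V]
    (Φ : V →ₗ[ℚ] V →ₗ[ℚ] ℚ)
    (hnd : ∀ x : V, (∀ y, Φ x y = 0) → x = 0)
    (L : Submodule ℤ V) (hfg : L.FG)
    (hspan : Submodule.span ℚ (L : Set V) = ⊤)
    (huni : integralPairing Φ L = L)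
    (S : Submodule ℤ V) (hSL : S ≤ L)
    (hprim : ∀ x ∈ L, ∀ n : ℤ, n ≠ 0 → n • x ∈ S → x ∈ S)
    (z : V) (hz : z ∈ integralPairing Φ S) :
    ∃ x ∈ L, ∀ y ∈ S, Φ x y = Φ z y := by
  haveI : Module.Finite ℤ L := Module.Finite.iff_fg.2 hfg
  let N : Submodule ℤ L := S.comap L.subtype
  haveI : Module.IsTorsionFree ℤ (L ⧸ N) := by
    refine Module.IsTorsionFree.of_smul_eq_zero fun n q h => ?_
    by_contra! hc
    obtain ⟨l, rfl⟩ := N.mkQ_surjective q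
    rw [← map_smul] at h
    simp only [Submodule.mkQ_apply, Submodule.Quotient.mk_eq_zero, ne_eq] at h hc
    exact hc.2 (hprim l l.2 n hc.1 h)
  haveI : Module.Free ℤ (L ⧸ N) := inferInstance
  obtain ⟨s, hs⟩ := Module.projective_lifting_property N.mkQ LinearMap.id N.mkQ_surjective
  let r : L →ₗ[ℤ] L := LinearMap.id - s.comp N.mkQ
  have hr : ∀ l, (r l : V) ∈ S := by
    intro l
    change r l ∈ N
    rw [← Submodule.Quotient.mk_eq_zero, ← Submodule.mkQ_apply]
    have := LinearMap.congr_fun hs (N.mkQ l)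
    simp only [LinearMap.comp_apply, LinearMap.id_apply] at this
    simp only [r, LinearMap.sub_apply, LinearMap.id_apply, LinearMap.comp_apply, map_sub, this,
      sub_self]
  have hr2 : ∀ l : L, (l : V) ∈ S → r l = l := by
    intro l hl
    have : N.mkQ l = 0 := (Submodule.Quotient.mk_eq_zero N).2 hl
    simp only [r, LinearMap.sub_apply, LinearMap.id_apply, LinearMap.comp_apply, this, map_zero,
      sub_zero]
  obtain ⟨R, hR⟩ := aux_extend L hfg hspan
    (((Φ z).restrictScalars ℤ).comp (L.subtype.comp r))
  have hinj : Function.Injective Φ := by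
    refine (injective_iff_map_eq_zero Φ).2 fun x hx => hnd x fun y => by rw [hx]; rfl
  have hsurj : Function.Surjective Φ :=
    (LinearMap.injective_iff_surjective_of_finrank_eq_finrank
      (Subspace.dual_finrank_eq (K := ℚ) (V := V)).symm).1 hinj
  obtain ⟨x, hx⟩ := hsurj R
  refine ⟨x, ?_, ?_⟩
  · rw [← huni]
    intro y hy
    obtain ⟨n, hn⟩ := hz _ (hr ⟨y, hy⟩)
    exact ⟨n, by rw [hx, hR ⟨y, hy⟩, ← hn]; rfl⟩
  · intro y hy
    rw [hx, hR ⟨y, hSL hy⟩]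
    change Φ z (r ⟨y, hSL hy⟩ : V) = _
    rw [hr2 _ hy]

lemma aux_map {V : Type*} [AddCommGroup V] [Module ℚ V] [FiniteDimensional ℚ V]
    (Φ : V →ₗ[ℚ] V →ₗ[ℚ] ℚ)
    (hnd : ∀ x : V, (∀ y, Φ x y = 0) → x = 0)
    (L : Submodule ℤ V) (hfg : L.FG)
    (hspan : Submodule.span ℚ (L : Set V) = ⊤)
    (hint : ∀ x ∈ L, ∀ y ∈ L, ∃ n : ℤ, Φ x y = (n : ℚ))
    (huni : integralPairing Φ L = L)
    (S : Submodule ℤ V) (hSL : S ≤ L)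
    (hprim : ∀ x ∈ L, ∀ n : ℤ, n ≠ 0 → n • x ∈ S → x ∈ S)
    (hSnd : ∀ x ∈ S, (∀ y ∈ S, Φ x y = 0) → x = 0)
    (p : V →ₗ[ℚ] V) (hp : ∀ x, p x ∈ Submodule.span ℚ (S : Set V))
    (ho : ∀ x, ∀ y ∈ S, Φ (p x) y = Φ x y) :
    ∃ g : L →ₗ[ℤ] discGroup Φ S, Function.Surjective g ∧
      ∀ (l : L) (z : ↥(dualLatticeIn Φ S)), g l = Submodule.Quotient.mk z ↔ p l - z ∈ S := by
  let g0 : L →ₗ[ℤ] ↥(dualLatticeIn Φ S) :=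
    LinearMap.codRestrict (dualLatticeIn Φ S) ((p.restrictScalars ℤ).comp L.subtype) (by
      intro l
      refine ⟨hp _, fun y hy => ?_⟩
      obtain ⟨n, hn⟩ := hint l l.2 y (hSL hy)
      exact ⟨n, by rw [← hn]; exact ho _ y hy⟩)
  let N := Submodule.comap (dualLatticeIn Φ S).subtype S
  have key : ∀ (l : L) (z : ↥(dualLatticeIn Φ S)),
      (N.mkQ.comp g0) l = Submodule.Quotient.mk z ↔ p l - z ∈ S := by
    intro l z
    exact Submodule.Quotient.eq N
  refine ⟨N.mkQ.comp g0, ?_, key⟩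
  intro q
  obtain ⟨z, rfl⟩ := N.mkQ_surjective q
  obtain ⟨x, hxL, hx⟩ := aux_lift Φ hnd L hfg hspan huni S hSL hprim z z.2.2
  refine ⟨⟨x, hxL⟩, (key _ _).2 ?_⟩
  have : p x - z = 0 := by
    refine aux_nd Φ S hSnd _ (Submodule.sub_mem _ (hp x) z.2.1) fun y hy => ?_
    rw [map_sub, LinearMap.sub_apply, ho x y hy, hx y hy, sub_self]
  change p x - z ∈ S
  rw [this]
  exact S.zero_mem

/-- Let `L` be an even unimodular lattice (a full finitely generated `ℤ`-submodule of a
finite-dimensional rational vector space `V` with symmetric non-degenerate `Φ`, the form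
being integral and even on `L`, and `L` equal to its own dual).  Let `M ≤ L` be a
primitive sublattice such that `M` and its orthogonal complement `M^⊥` are
non-degenerate.  Then there is an isomorphism of abelian groups `f : A(M) ≅ A(M^⊥)`
under which the discriminant quadratic form `q(M)` corresponds to `−q(M^⊥)`:
whenever `f(x mod M) = y mod M^⊥` one has `⟨y,y⟩ + ⟨x,x⟩ ∈ 2ℤ`. -/
theorem stmt_4 {V : Type*} [AddCommGroup V] [Module ℚ V] [FiniteDimensional ℚ V]
    (Φ : V →ₗ[ℚ] V →ₗ[ℚ] ℚ)
    (hsymm : ∀ x y, Φ x y = Φ y x)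
    (hnd : ∀ x : V, (∀ y, Φ x y = 0) → x = 0)
    (L : Submodule ℤ V) (hfg : L.FG)
    (hspan : Submodule.span ℚ (L : Set V) = ⊤)
    (hint : ∀ x ∈ L, ∀ y ∈ L, ∃ n : ℤ, Φ x y = (n : ℚ))
    (heven : ∀ x ∈ L, ∃ n : ℤ, Φ x x = 2 * (n : ℚ))
    (huni : integralPairing Φ L = L)
    (M : Submodule ℤ V) (hML : M ≤ L)
    (hprim : ∀ x ∈ L, ∀ n : ℤ, n ≠ 0 → n • x ∈ M → x ∈ M)
    (hMnd : ∀ x ∈ M, (∀ y ∈ M, Φ x y = 0) → x = 0)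
    (hPnd : ∀ x ∈ perpIn Φ L M, (∀ y ∈ perpIn Φ L M, Φ x y = 0) → x = 0) :
    ∃ f : discGroup Φ M ≃+ discGroup Φ (perpIn Φ L M),
      ∀ (x : ↥(dualLatticeIn Φ M)) (y : ↥(dualLatticeIn Φ (perpIn Φ L M))),
        f (Submodule.Quotient.mk x) = Submodule.Quotient.mk y →
        ∃ n : ℤ, Φ (y : V) (y : V) + Φ (x : V) (x : V) = 2 * (n : ℚ) := by
  have hPL : perpIn Φ L M ≤ L := fun x hx => hx.1
  have hPprim : ∀ x ∈ L, ∀ n : ℤ, n ≠ 0 → n • x ∈ perpIn Φ L M → x ∈ perpIn Φ L M := by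
    intro x hx n hn h
    refine ⟨hx, fun y hy => ?_⟩
    have := h.2 y hy
    rw [aux_map_zsmul] at this
    exact (mul_eq_zero.1 this).resolve_left (by exact_mod_cast hn)
  have hrefl : LinearMap.BilinForm.IsRefl Φ := fun x y h => by rw [hsymm]; exact h
  set W := Submodule.span ℚ (M : Set V) with hW
  have hWnd : (LinearMap.BilinForm.restrict Φ W).Nondegenerate := by
    have h1 : ∀ x : W, (∀ y : W, Φ x y = 0) → x = 0 := by
      intro x hx
      exact Subtype.ext (aux_nd Φ M hMnd x x.2
        fun y hy => hx ⟨y, Submodule.subset_span hy⟩)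
    exact ⟨h1, fun x hx => h1 x fun y => by rw [hsymm]; exact hx y⟩
  have hcompl := LinearMap.BilinForm.isCompl_orthogonal_of_restrict_nondegenerate hrefl hWnd
  set p := W.projection _ hcompl with hpdef
  have hp : ∀ x, p x ∈ W := fun x => Submodule.projection_apply_mem hcompl x
  have hq : ∀ x, ∀ y ∈ W, Φ (x - p x) y = 0 := by
    intro x y hy
    have : x - p x ∈ LinearMap.BilinForm.orthogonal Φ W := by
      rw [← Submodule.projection_apply_eq_zero_iff hcompl, map_sub, ← hpdef,
        hpdef, Submodule.projection_apply_of_mem_left hcompl (hp x), sub_self]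
    rw [hsymm]
    exact this y hy
  have hqP : ∀ x, x - p x ∈ Submodule.span ℚ (perpIn Φ L M : Set V) := by
    intro x
    obtain ⟨n, hn, h⟩ := aux_clear L (x - p x) (by rw [hspan]; trivial)
    have h2 : n • (x - p x) ∈ perpIn Φ L M := by
      refine ⟨h, fun y hy => ?_⟩
      rw [aux_map_zsmul, hq x y (Submodule.subset_span hy), mul_zero]
    have h3 := Submodule.smul_mem _ ((n : ℚ)⁻¹) (Submodule.subset_span (R := ℚ) h2)
    rwa [← Int.cast_smul_eq_zsmul ℚ, smul_smul, inv_mul_cancel₀ (by exact_mod_cast hn),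
      one_smul] at h3
  have hPW : ∀ y ∈ perpIn Φ L M, ∀ w ∈ W, Φ y w = 0 := fun y hy => aux_orth Φ _ y hy.2
  have hWP : ∀ w ∈ W, ∀ u ∈ Submodule.span ℚ (perpIn Φ L M : Set V), Φ w u = 0 :=
    fun w hw => aux_orth Φ _ w fun y hy => by rw [hsymm]; exact hPW y hy w hw
  obtain ⟨g, hg, hgk⟩ := aux_map Φ hnd L hfg hspan hint huni M hML hprim hMnd p hp (by
    intro x y hy
    have := hq x y (Submodule.subset_span hy)
    rw [map_sub, LinearMap.sub_apply] at this
    linarith)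
  obtain ⟨g', hg', hgk'⟩ := aux_map Φ hnd L hfg hspan hint huni (perpIn Φ L M) hPL hPprim hPnd
    (LinearMap.id - p) hqP (by
      intro x y hy
      have := hPW y hy (p x) (hp x)
      rw [hsymm] at this
      simp [this])
  have hker : LinearMap.ker g = LinearMap.ker g' := by
    ext l
    have e1 := hgk l 0
    have e2 := hgk' l 0
    rw [Submodule.Quotient.mk_zero] at e1 e2
    simp only [ZeroMemClass.coe_zero, sub_zero] at e1 e2
    rw [LinearMap.mem_ker, LinearMap.mem_ker, e1, e2]
    change _ ↔ (l : V) - p l ∈ _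
    constructor
    · intro h
      exact ⟨L.sub_mem l.2 (hML h), fun y hy => hq _ y (Submodule.subset_span hy)⟩
    · intro h
      have hL : p l ∈ L := by
        have := L.sub_mem l.2 h.1
        rwa [sub_sub_cancel] at this
      obtain ⟨n, hn, hn2⟩ := aux_clear M (p l) (hp _)
      exact hprim _ hL n hn hn2
  let f := (g.quotKerEquivOfSurjective hg).symm.trans
    ((Submodule.quotEquivOfEq _ _ hker).trans (g'.quotKerEquivOfSurjective hg'))
  have hf : ∀ l, f (g l) = g' l := by
    intro l
    simp only [f, LinearEquiv.trans_apply, LinearMap.quotKerEquivOfSurjective_symm_apply,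
      Submodule.quotEquivOfEq_mk, LinearMap.quotKerEquivOfSurjective_apply_mk]
  refine ⟨f.toAddEquiv, fun x y hxy => ?_⟩
  obtain ⟨l, hl⟩ := hg (Submodule.Quotient.mk x)
  have hxy' : f (Submodule.Quotient.mk x) = Submodule.Quotient.mk y := hxy
  rw [← hl, hf] at hxy'
  have h1 := hML ((hgk l x).1 hl)
  have h2 := hPL ((hgk' l y).1 hxy')
  have h3 : (x : V) + y ∈ L := by
    have := L.sub_mem l.2 (L.add_mem h1 h2)
    have e : (l : V) - (p l - x + ((LinearMap.id - p : V →ₗ[ℚ] V) l - y)) = x + y := by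
      simp only [LinearMap.sub_apply, LinearMap.id_apply]
      abel
    rwa [e] at this
  obtain ⟨n, hn⟩ := heven _ h3
  refine ⟨n, ?_⟩
  have h4 : Φ (x : V) (y : V) = 0 := hWP x x.2.1 y y.2.1
  have h5 : Φ (y : V) (x : V) = 0 := by rw [hsymm]; exact h4
  rw [← hn]
  simp only [map_add, LinearMap.add_apply, h4, h5]
  ring
end

section
/- Let Λ be an additive subgroup of ℂ³ that is stable under the two maps a₀ : (z₁,z₂,z₃) ↦ (z₁,−z₂,−z₃) and b₀ : (z₁,z₂,z₃) ↦ (−z₁,z₂,−z₃). For i = 1,2,3 define Λ'_i := {z ∈ ℂ | z·e_i ∈ Λ}, where e₁,e₂,e₃ is the standard basis of ℂ³, and set Λ' := Λ'₁ × Λ'₂ × Λ'₃ ⊆ ℂ³. Then Λ' ⊆ Λ and 2Λ ⊆ Λ'; consequently the quotient group Λ/Λ' is an elementary abelian 2-group (every element has order dividing 2). -/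
/-- For an additive subgroup `Λ ⊆ ℂ³`, the subgroup
`Λ' = Λ'₁ × Λ'₂ × Λ'₃` where `Λ'ᵢ = {z ∈ ℂ | z·eᵢ ∈ Λ}`. -/
noncomputable def lamPrime (Λ : AddSubgroup (ℂ × ℂ × ℂ)) : AddSubgroup (ℂ × ℂ × ℂ) where
  carrier := {v | (v.1, 0, 0) ∈ Λ ∧ ((0 : ℂ), v.2.1, (0 : ℂ)) ∈ Λ ∧ ((0 : ℂ), (0 : ℂ), v.2.2) ∈ Λ}
  add_mem' := by
    rintro a b ⟨ha1, ha2, ha3⟩ ⟨hb1, hb2, hb3⟩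
    refine ⟨?_, ?_, ?_⟩
    · simpa using Λ.add_mem ha1 hb1
    · simpa using Λ.add_mem ha2 hb2
    · simpa using Λ.add_mem ha3 hb3
  zero_mem' := ⟨Λ.zero_mem, Λ.zero_mem, Λ.zero_mem⟩
  neg_mem' := by
    rintro a ⟨ha1, ha2, ha3⟩
    refine ⟨?_, ?_, ?_⟩
    · simpa using Λ.neg_mem ha1
    · simpa using Λ.neg_mem ha2
    · simpa using Λ.neg_mem ha3

/-- Let `Λ` be an additive subgroup of `ℂ³` stable under
`a₀ : (z₁,z₂,z₃) ↦ (z₁,−z₂,−z₃)` and `b₀ : (z₁,z₂,z₃) ↦ (−z₁,z₂,−z₃)`, and let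
`Λ' = Λ'₁ × Λ'₂ × Λ'₃` with `Λ'ᵢ = {z | z·eᵢ ∈ Λ}`.  Then `Λ' ⊆ Λ` and `2Λ ⊆ Λ'`;
consequently every element of the quotient `Λ/Λ'` has order dividing 2. -/
theorem stmt_12 (Λ : AddSubgroup (ℂ × ℂ × ℂ))
    (ha : ∀ v ∈ Λ, (v.1, -v.2.1, -v.2.2) ∈ Λ)
    (hb : ∀ v ∈ Λ, (-v.1, v.2.1, -v.2.2) ∈ Λ) :
    lamPrime Λ ≤ Λ ∧ (∀ v ∈ Λ, (2 : ℤ) • v ∈ lamPrime Λ) ∧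
    ∀ x : (↥Λ ⧸ ((lamPrime Λ).addSubgroupOf Λ)), x + x = 0 := by
  have h2 : ∀ v ∈ Λ, (2 : ℤ) • v ∈ lamPrime Λ := by
    intro v hv
    have h1 := Λ.add_mem hv (ha v hv)
    have h2 := Λ.add_mem hv (hb v hv)
    have h3 := Λ.add_mem hv (ha _ (hb v hv))
    obtain ⟨x, y, z⟩ := v
    rw [two_zsmul]
    refine ⟨?_, ?_, ?_⟩
    · simpa using h1
    · simpa using h2
    · simpa using h3
  refine ⟨?_, h2, ?_⟩
  · rintro ⟨x, y, z⟩ ⟨h1, h2, h3⟩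
    simpa using Λ.add_mem (Λ.add_mem h1 h2) h3
  · intro x
    induction x using QuotientAddGroup.induction_on with
    | H v =>
      rw [← QuotientAddGroup.mk_add, QuotientAddGroup.eq_zero_iff, AddSubgroup.mem_addSubgroupOf]
      have := h2 v v.2
      rw [two_zsmul] at this
      exact this
end
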